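/- (Monte Carlo lower-deviation bound, eq. (c2)) Let Z₁,…,Z_R be i.i.d. N(0, I_n) random vectors and let W ~ N(0, σ²I_n). Then for every q ∈ [1,∞] and every t ≥ 0, P{ E[‖(1/n)XᵀW‖_q] ≥ (σ/R) ∑_{r=1}^R ‖(1/n)XᵀZ_r‖_q + t } ≤ exp( −nR t² / (2σ² N_q(X)²) ). -/

import Mathlib

open MeasureTheory ProbabilityTheory
open scoped ENNReal NNReal

noncomputable def lqNorm (q : ℝ≥0∞) {L : ℕ} (v : Fin L → ℝ) : ℝ :=
  (eLpNorm v q Measure.count).toReal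

noncomputable def Nq (q : ℝ≥0∞) {n L : ℕ} (X : Fin n → Fin L → ℝ) : ℝ :=
  lqNorm q (fun j => Real.sqrt ((1 / (n : ℝ)) * ∑ i, (X i j) ^ 2))

noncomputable def gaussianVec (n : ℕ) (σ : ℝ) : Measure (Fin n → ℝ) :=
  Measure.pi (fun _ => gaussianReal 0 ⟨σ ^ 2, sq_nonneg σ⟩)

section conc
variable {E : Type*} [NormedAddCommGroup E] [InnerProductSpace ℝ E] [FiniteDimensional ℝ E]
  [MeasurableSpace E] [BorelSpace E]

lemma integrable_exp_norm_stdG (c : ℝ) :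
    Integrable (fun x => Real.exp (c * ‖x‖)) (stdGaussian E) := by
  obtain ⟨C, hC, h⟩ := IsGaussian.exists_integrable_exp_sq (stdGaussian E)
  refine Integrable.mono' (h.const_mul (Real.exp (c ^ 2 / (4 * C)))) (by fun_prop) ?_
  filter_upwards with x
  rw [Real.norm_eq_abs, Real.abs_exp, ← Real.exp_add]
  apply Real.exp_le_exp.2
  have : c ^ 2 / (4 * C) + C * ‖x‖ ^ 2 - c * ‖x‖ = (c - 2 * C * ‖x‖) ^ 2 / (4 * C) := by
    field_simp; ring
  have h2 : 0 ≤ (c - 2 * C * ‖x‖) ^ 2 / (4 * C) := by positivity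
  linarith

lemma integral_inner_sq_stdG (v : E) :
    Integrable (fun w => (inner ℝ v w) ^ 2) (stdGaussian E) ∧
    ∫ w, (inner ℝ v w) ^ 2 ∂(stdGaussian E) = ‖v‖ ^ 2 := by
  constructor
  · have h := (IsGaussian.memLp_two_id (μ := stdGaussian E))
    have := (h.continuousLinearMap_comp (innerSL ℝ v)).integrable_sq
    simpa using this
  · have h := variance_dual_stdGaussian (innerSL ℝ v : StrongDual ℝ E)
    rw [variance_of_integral_eq_zero (by fun_prop) (integral_strongDual_stdGaussian _)] at h
    simpa using h

lemma stein_bound (g : E → ℝ) (M : ℝ) (hM : 0 ≤ M) (hg : ∀ x y, |g x - g y| ≤ M * ‖x - y‖)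
    (l : StrongDual ℝ E) (hint : Integrable (fun w => g w * l w) (stdGaussian E)) :
    |∫ w, g w * l w ∂(stdGaussian E)| ≤ M * ‖l‖ := by
  obtain ⟨v, rfl⟩ := (InnerProductSpace.toDual ℝ E).surjective l
  simp only [InnerProductSpace.toDual_apply_apply, LinearIsometryEquiv.norm_map] at hint ⊢
  by_cases hv : v = 0
  · simp [hv]
  have hv' : 0 < ‖v‖ := norm_pos_iff.2 hv
  set ρ := (ℝ ∙ v)ᗮ.reflection
  have hρ : ∀ w, ρ w = w - (2 * (inner ℝ v w / ‖v‖ ^ 2)) • v := by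
    intro w
    simp [ρ, Submodule.reflection_orthogonal, Submodule.reflection_singleton_apply, mul_smul, two_smul]
  have hin : ∀ w, inner ℝ v (ρ w) = - inner ℝ v w := by
    intro w
    rw [hρ, inner_sub_right, inner_smul_right, real_inner_self_eq_norm_sq]
    field_simp; ring
  have hmp : MeasurePreserving ρ (stdGaussian E) (stdGaussian E) :=
    ⟨ρ.continuous.measurable, stdGaussian_map ρ⟩
  have hme : MeasurableEmbedding ρ := ρ.toHomeomorph.measurableEmbedding
  have e1 := hmp.integral_comp hme (fun w => g w * inner ℝ v w)
  have i1 : Integrable (fun w => g (ρ w) * inner ℝ v (ρ w)) (stdGaussian E) :=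
    hmp.integrable_comp_of_integrable hint
  have e2 : 2 * ∫ w, g w * inner ℝ v w ∂(stdGaussian E)
      = ∫ w, (g w - g (ρ w)) * inner ℝ v w ∂(stdGaussian E) := by
    rw [two_mul]
    nth_rw 2 [← e1]
    rw [← integral_add hint i1]
    congr 1; ext w; rw [hin]; ring
  have hs := integral_inner_sq_stdG v
  have e3 : |∫ w, (g w - g (ρ w)) * inner ℝ v w ∂(stdGaussian E)|
      ≤ ∫ w, (2 * M / ‖v‖) * (inner ℝ v w) ^ 2 ∂(stdGaussian E) := by
    rw [← Real.norm_eq_abs]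
    apply norm_integral_le_of_norm_le (hs.1.const_mul _)
    filter_upwards with w
    rw [Real.norm_eq_abs, abs_mul]
    have h1 := hg w (ρ w)
    have h2 : ‖w - ρ w‖ = 2 * |inner ℝ v w| / ‖v‖ := by
      rw [hρ]
      simp [norm_smul]
      field_simp
    rw [h2] at h1
    calc _ ≤ (M * (2 * |inner ℝ v w| / ‖v‖)) * |inner ℝ v w| := by gcongr
      _ = (2 * M / ‖v‖) * |inner ℝ v w| ^ 2 := by ring
      _ = _ := by rw [sq_abs]
  rw [integral_const_mul, hs.2, ← e2, abs_mul, abs_two] at e3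
  have : 2 * M / ‖v‖ * ‖v‖ ^ 2 = 2 * (M * ‖v‖) := by field_simp
  linarith


lemma cov_bound (F : E → ℝ) (hF1 : ContDiff ℝ 1 F) (M : ℝ) (hM : 0 ≤ M)
    (hF : ∀ x y, |F x - F y| ≤ M * ‖x - y‖) (s : ℝ) (hs : 0 ≤ s) :
    ∫ x, F x * Real.exp (s * F x) ∂(stdGaussian E)
      ≤ ((∫ x, F x ∂(stdGaussian E)) + s * M ^ 2) * ∫ x, Real.exp (s * F x) ∂(stdGaussian E) := by
  set γ := stdGaussian E with hγ
  have hFc : Continuous F := hF1.continuous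
  have hFd : Differentiable ℝ F := hF1.differentiable (by norm_num)
  have hFD : Continuous (fderiv ℝ F) := hF1.continuous_fderiv (by norm_num)
  have hFn : ∀ x, ‖fderiv ℝ F x‖ ≤ M := by
    intro x
    refine norm_fderiv_le_of_lip' ℝ hM ?_
    filter_upwards with y
    simpa using hF y x
  set A := |F 0| with hA
  have hA0 : 0 ≤ A := abs_nonneg _
  have hb : ∀ x, |F x| ≤ A + M * ‖x‖ := by
    intro x
    have h1 := hF x 0
    rw [sub_zero] at h1
    have := abs_sub_abs_le_abs_sub (F x) (F 0)
    linarith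
  set c := M + s * M + 1 with hc
  -- common dominating function
  set D : E × E → ℝ := fun p => Real.exp ((1 + s) * A) * (Real.exp (c * ‖p.1‖) * Real.exp (c * ‖p.2‖))
    with hD
  have hDint : Integrable D (γ.prod γ) :=
    ((integrable_exp_norm_stdG c).mul_prod (integrable_exp_norm_stdG c)).const_mul _
  have hZ : ∀ (a b : ℝ) (p : E × E), |a| ≤ 1 → |b| ≤ 1 → ‖a • p.1 + b • p.2‖ ≤ ‖p.1‖ + ‖p.2‖ := by
    intro a b p ha hb
    refine (norm_add_le _ _).trans ?_
    rw [norm_smul, norm_smul, Real.norm_eq_abs, Real.norm_eq_abs]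
    have := mul_le_mul_of_nonneg_right ha (norm_nonneg p.1)
    have := mul_le_mul_of_nonneg_right hb (norm_nonneg p.2)
    linarith
  have key : ∀ (p : E × E) (x y z : E), ‖x‖ ≤ ‖p.1‖ + ‖p.2‖ → ‖y‖ ≤ ‖p.1‖ + ‖p.2‖ →
      ‖z‖ ≤ ‖p.1‖ + ‖p.2‖ →
      |F x| * (Real.exp (s * F y) * (1 + ‖z‖)) ≤ D p := by
    intro p x y z hx hy hz
    set N := ‖p.1‖ + ‖p.2‖ with hN
    have h1 : |F x| ≤ Real.exp (A + M * N) := by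
      have := hb x
      have := Real.add_one_le_exp (A + M * N)
      have := mul_le_mul_of_nonneg_left hx hM
      linarith
    have h2 : Real.exp (s * F y) ≤ Real.exp (s * (A + M * N)) := by
      apply Real.exp_le_exp.2
      apply mul_le_mul_of_nonneg_left _ hs
      have := hb y
      have := le_abs_self (F y)
      have := mul_le_mul_of_nonneg_left hy hM
      linarith
    have h3 : 1 + ‖z‖ ≤ Real.exp N := by
      have := Real.add_one_le_exp N
      linarith
    calc _ ≤ Real.exp (A + M * N) * (Real.exp (s * (A + M * N)) * Real.exp N) := by gcongr
      _ = D p := by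
        simp only [hD, ← Real.exp_add]
        congr 1
        rw [hc, hN]; ring
  -- H
  set f : ℝ → E × E → ℝ := fun θ p =>
    F p.1 * Real.exp (s * F (Real.cos θ • p.1 + Real.sin θ • p.2)) with hf
  set f' : ℝ → E × E → ℝ := fun θ p =>
    F p.1 * (Real.exp (s * F (Real.cos θ • p.1 + Real.sin θ • p.2)) *
      (s * fderiv ℝ F (Real.cos θ • p.1 + Real.sin θ • p.2)
        (-Real.sin θ • p.1 + Real.cos θ • p.2))) with hf'
  have hcos := Real.abs_cos_le_one
  have hsin := Real.abs_sin_le_one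
  have hsin' : ∀ θ, |-Real.sin θ| ≤ 1 := fun θ => by rw [abs_neg]; exact hsin θ
  have hfc : ∀ θ, Continuous (f θ) := fun θ => by simp only [hf]; fun_prop
  have hf'c : ∀ θ, Continuous (f' θ) := fun θ => by simp only [hf']; fun_prop
  have hfint : ∀ θ, Integrable (f θ) (γ.prod γ) := by
    intro θ
    refine hDint.mono' (hfc θ).aestronglyMeasurable ?_
    filter_upwards with p
    rw [Real.norm_eq_abs, hf, abs_mul, Real.abs_exp]
    have := key p p.1 (Real.cos θ • p.1 + Real.sin θ • p.2) 0 (by simp)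
      (hZ _ _ p (hcos θ) (hsin θ)) (by simp; positivity)
    simpa using this
  have hlin : ∀ x z, |s * fderiv ℝ F x z| ≤ s * M * (1 + ‖z‖) := by
    intro x z
    rw [abs_mul, abs_of_nonneg hs, mul_assoc]
    apply mul_le_mul_of_nonneg_left _ hs
    have h1 := (fderiv ℝ F x).le_opNorm z
    have h2 := mul_le_mul_of_nonneg_right (hFn x) (norm_nonneg z)
    rw [Real.norm_eq_abs] at h1
    linarith
  have hf'b : ∀ θ p, ‖f' θ p‖ ≤ s * M * D p := by
    intro θ p
    rw [Real.norm_eq_abs, hf', abs_mul, abs_mul, Real.abs_exp]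
    have h1 := key p p.1 (Real.cos θ • p.1 + Real.sin θ • p.2)
      (-Real.sin θ • p.1 + Real.cos θ • p.2) (by simp)
      (hZ _ _ p (hcos θ) (hsin θ)) (hZ _ _ p (hsin' θ) (hcos θ))
    have h2 := hlin (Real.cos θ • p.1 + Real.sin θ • p.2) (-Real.sin θ • p.1 + Real.cos θ • p.2)
    have h3 := mul_le_mul_of_nonneg_left h1 (mul_nonneg hs hM)
    refine le_trans ?_ h3
    calc _ ≤ |F p.1| * (Real.exp (s * F (Real.cos θ • p.1 + Real.sin θ • p.2)) *
              (s * M * (1 + ‖-Real.sin θ • p.1 + Real.cos θ • p.2‖))) := by gcongr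
      _ = _ := by ring
  have hderiv : ∀ θ, HasDerivAt (fun θ => ∫ p, f θ p ∂(γ.prod γ)) (∫ p, f' θ p ∂(γ.prod γ)) θ := by
    intro θ
    refine (hasDerivAt_integral_of_dominated_loc_of_deriv_le (s := Set.univ) Filter.univ_mem
      (Filter.Eventually.of_forall fun θ => (hfc θ).aestronglyMeasurable) (hfint θ)
      (hf'c θ).aestronglyMeasurable (bound := fun p => s * M * D p) ?_ (hDint.const_mul _) ?_).2
    · filter_upwards with p θ _ using hf'b θ p
    · filter_upwards with p θ _
      have h1 : HasDerivAt (fun θ => Real.cos θ • p.1 + Real.sin θ • p.2)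
          (-Real.sin θ • p.1 + Real.cos θ • p.2) θ :=
        ((Real.hasDerivAt_cos θ).smul_const p.1).add ((Real.hasDerivAt_sin θ).smul_const p.2)
      have h2 := (hFd (Real.cos θ • p.1 + Real.sin θ • p.2)).hasFDerivAt.comp_hasDerivAt θ h1
      exact ((h2.const_mul s).exp).const_mul (F p.1)
  have hKint : Integrable (fun z => Real.exp (s * F z)) γ := by
    refine ((integrable_exp_norm_stdG (s * M)).const_mul (Real.exp (s * A))).mono'
      (by fun_prop) ?_
    filter_upwards with z
    rw [Real.norm_eq_abs, Real.abs_exp, ← Real.exp_add]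
    apply Real.exp_le_exp.2
    have := mul_le_mul_of_nonneg_left ((le_abs_self _).trans (hb z)) hs
    linarith
  set K := ∫ x, Real.exp (s * F x) ∂γ with hK
  have hbound : ∀ θ, |∫ p, f' θ p ∂(γ.prod γ)| ≤ s * M ^ 2 * K * |Real.sin θ| := by
    intro θ
    set G : E × E → ℝ := fun q => F (Real.cos θ • q.1 + -Real.sin θ • q.2) *
      (Real.exp (s * F q.1) * (s * fderiv ℝ F q.1 q.2)) with hG
    have hGc : Continuous G := by simp only [hG]; fun_prop
    have hrot := IsGaussian.map_rotation_eq_self (μ := γ) (by simp [hγ]) θ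
    have hGint : Integrable G (γ.prod γ) := by
      refine (hDint.const_mul (s * M)).mono' hGc.aestronglyMeasurable ?_
      filter_upwards with p
      rw [Real.norm_eq_abs, hG, abs_mul, abs_mul, Real.abs_exp]
      have h1 := key p (Real.cos θ • p.1 + -Real.sin θ • p.2) p.1 p.2
        (hZ _ _ p (hcos θ) (hsin' θ)) (by simp) (by simp)
      have h2 := hlin p.1 p.2
      have h3 := mul_le_mul_of_nonneg_left h1 (mul_nonneg hs hM)
      refine le_trans ?_ h3
      calc _ ≤ |F (Real.cos θ • p.1 + -Real.sin θ • p.2)| * (Real.exp (s * F p.1) *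
              (s * M * (1 + ‖p.2‖))) := by gcongr
        _ = _ := by ring
    have e1 : ∫ p, f' θ p ∂(γ.prod γ) = ∫ q, G q ∂(γ.prod γ) := by
      conv_rhs => rw [← hrot]
      rw [integral_map (by fun_prop) hGc.aestronglyMeasurable]
      congr 1; ext p
      simp only [hf', hG, ContinuousLinearMap.rotation_apply]
      congr 2
      have := Real.sin_sq_add_cos_sq θ
      have h4 : Real.cos θ • (Real.cos θ • p.1 + Real.sin θ • p.2) +
        -Real.sin θ • (-Real.sin θ • p.1 + Real.cos θ • p.2) =
          (Real.sin θ ^ 2 + Real.cos θ ^ 2) • p.1 := by module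
      rw [h4, this, one_smul]
    rw [e1, integral_prod _ hGint, ← Real.norm_eq_abs]
    have e2 : s * M ^ 2 * K * |Real.sin θ| = ∫ z, s * M ^ 2 * |Real.sin θ| * Real.exp (s * F z) ∂γ := by
      rw [integral_const_mul]; ring
    rw [e2]
    apply norm_integral_le_of_norm_le (hKint.const_mul _)
    filter_upwards [hGint.prod_right_ae] with z hz
    have e3 : (fun w => G (z, w)) = fun w => (s * Real.exp (s * F z)) *
        (F (Real.cos θ • z + -Real.sin θ • w) * fderiv ℝ F z w) := by
      ext w; simp only [hG]; ring
    rw [e3] at hz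
    rw [e3, integral_const_mul, Real.norm_eq_abs, abs_mul, abs_mul, Real.abs_exp, abs_of_nonneg hs]
    by_cases hs0 : s = 0
    · simp [hs0]
    have hz' : Integrable (fun w => F (Real.cos θ • z + -Real.sin θ • w) * fderiv ℝ F z w) γ := by
      refine (integrable_const_mul_iff (IsUnit.mk0 _ ?_) _).1 hz
      positivity
    have h5 := stein_bound (fun w => F (Real.cos θ • z + -Real.sin θ • w)) (M * |Real.sin θ|)
      (by positivity) ?_ (fderiv ℝ F z) hz'
    · have h6 : |∫ w, F (Real.cos θ • z + -Real.sin θ • w) * fderiv ℝ F z w ∂γ|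
          ≤ M * |Real.sin θ| * M := h5.trans (by have := hFn z; gcongr)
      calc _ ≤ s * Real.exp (s * F z) * (M * |Real.sin θ| * M) := by gcongr
        _ = _ := by ring
    · intro x y
      refine (hF _ _).trans_eq ?_
      have : Real.cos θ • z + -Real.sin θ • x - (Real.cos θ • z + -Real.sin θ • y)
        = -Real.sin θ • (x - y) := by module
      rw [this, norm_smul, Real.norm_eq_abs, abs_neg]; ring
  -- monotonicity
  have hmono : MonotoneOn (fun θ => (∫ p, f θ p ∂(γ.prod γ)) - s * M ^ 2 * K * Real.cos θ)
      (Set.Icc 0 (Real.pi / 2)) := by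
    have hd : ∀ θ, HasDerivAt (fun θ => (∫ p, f θ p ∂(γ.prod γ)) - s * M ^ 2 * K * Real.cos θ)
        ((∫ p, f' θ p ∂(γ.prod γ)) - s * M ^ 2 * K * (-Real.sin θ)) θ := fun θ =>
      (hderiv θ).sub ((Real.hasDerivAt_cos θ).const_mul _)
    refine monotoneOn_of_deriv_nonneg (convex_Icc _ _)
      (fun θ _ => (hd θ).continuousAt.continuousWithinAt)
      (fun θ _ => (hd θ).differentiableAt.differentiableWithinAt) ?_
    intro θ hθ
    rw [interior_Icc] at hθ
    rw [(hd θ).deriv]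
    have h1 := hbound θ
    rw [abs_of_nonneg (Real.sin_nonneg_of_nonneg_of_le_pi hθ.1.le
      (by linarith [hθ.2, Real.pi_pos]))] at h1
    have := (abs_le.1 h1).1
    linarith
  have hfin := hmono (Set.left_mem_Icc.2 (by positivity)) (Set.right_mem_Icc.2 (by positivity))
    (by positivity)
  simp only [hf, Real.cos_zero, Real.sin_zero, Real.cos_pi_div_two, Real.sin_pi_div_two, one_smul,
    zero_smul, add_zero, zero_add] at hfin
  rw [integral_prod_mul (fun x => F x) (fun y => Real.exp (s * F y)), ← hK,
    integral_fun_fst (fun x => F x * Real.exp (s * F x))] at hfin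
  simp at hfin
  linarith

lemma mgf_bound_smooth (F : E → ℝ) (hF1 : ContDiff ℝ 1 F) (M : ℝ) (hM : 0 ≤ M)
    (hF : ∀ x y, |F x - F y| ≤ M * ‖x - y‖) (s : ℝ) (hs : 0 ≤ s) :
    ∫ x, Real.exp (s * F x) ∂(stdGaussian E)
      ≤ Real.exp (s * (∫ x, F x ∂(stdGaussian E)) + M ^ 2 * s ^ 2 / 2) := by
  set m := ∫ x, F x ∂(stdGaussian E) with hm
  have hFc : Continuous F := hF1.continuous
  have hb : ∀ x, |F x| ≤ |F 0| + M * ‖x‖ := by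
    intro x
    have h1 := hF x 0
    rw [sub_zero] at h1
    have := abs_sub_abs_le_abs_sub (F x) (F 0)
    linarith
  have hint : ∀ u : ℝ, Integrable (fun x => Real.exp (u * F x)) (stdGaussian E) := by
    intro u
    refine ((integrable_exp_norm_stdG (|u| * M)).const_mul (Real.exp (|u| * |F 0|))).mono'
      (by fun_prop) ?_
    filter_upwards with z
    rw [Real.norm_eq_abs, Real.abs_exp, ← Real.exp_add]
    apply Real.exp_le_exp.2
    have := mul_le_mul_of_nonneg_left (hb z) (abs_nonneg u)
    have h2 := le_abs_self (u * F z)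
    rw [abs_mul] at h2
    linarith
  have hset : integrableExpSet F (stdGaussian E) = Set.univ := by
    ext u; simp [integrableExpSet, hint u]
  have hd : ∀ u, HasDerivAt (mgf F (stdGaussian E))
      (∫ x, F x * Real.exp (u * F x) ∂(stdGaussian E)) u := fun u =>
    hasDerivAt_mgf (by rw [hset]; simp)
  have hd2 : ∀ u, HasDerivAt (fun u => mgf F (stdGaussian E) u * Real.exp (-(u * m + M ^ 2 * u ^ 2 / 2)))
      ((∫ x, F x * Real.exp (u * F x) ∂(stdGaussian E)) * Real.exp (-(u * m + M ^ 2 * u ^ 2 / 2))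
        + mgf F (stdGaussian E) u * (Real.exp (-(u * m + M ^ 2 * u ^ 2 / 2)) * (-(m + M ^ 2 * u)))) u := by
    intro u
    refine (hd u).mul (HasDerivAt.exp ?_)
    have h1 := ((hasDerivAt_id u).mul_const m).add
      ((((hasDerivAt_id u).pow 2).const_mul (M ^ 2)).div_const 2)
    convert! h1.neg using 1
    simp; ring
  have hanti : AntitoneOn (fun u => mgf F (stdGaussian E) u * Real.exp (-(u * m + M ^ 2 * u ^ 2 / 2)))
      (Set.Ici 0) := by
    refine antitoneOn_of_deriv_nonpos (convex_Ici _)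
      (fun θ _ => (hd2 θ).continuousAt.continuousWithinAt)
      (fun θ _ => (hd2 θ).differentiableAt.differentiableWithinAt) ?_
    intro u hu
    rw [interior_Ici] at hu
    rw [(hd2 u).deriv]
    have h1 := cov_bound F hF1 M hM hF u (le_of_lt hu)
    have h2 : (0:ℝ) ≤ Real.exp (-(u * m + M ^ 2 * u ^ 2 / 2)) := (Real.exp_pos _).le
    have h3 := mul_le_mul_of_nonneg_right h1 h2
    simp only [mgf]
    linarith
  have h := hanti (Set.mem_Ici.2 le_rfl) (Set.mem_Ici.2 hs) hs
  simp only [mgf] at h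
  simp at h
  have e : -(M ^ 2 * s ^ 2 / 2) + -(s * m) = -(s * m + M ^ 2 * s ^ 2 / 2) := by ring
  rw [e, Real.exp_neg, ← div_eq_mul_inv, div_le_one (Real.exp_pos _)] at h
  exact h

lemma mollify (F : E → ℝ) (M : ℝ) (hM : 0 ≤ M)
    (hF : ∀ x y, |F x - F y| ≤ M * ‖x - y‖) (δ : ℝ) (hδ : 0 < δ) :
    ∃ g : E → ℝ, ContDiff ℝ 1 g ∧ (∀ x y, |g x - g y| ≤ M * ‖x - y‖) ∧
      ∀ x, |g x - F x| ≤ M * δ := by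
  have hFc : Continuous F := by
    have : LipschitzWith (Real.toNNReal M) F := by
      apply LipschitzWith.of_dist_le_mul
      intro x y
      rw [Real.dist_eq, dist_eq_norm, Real.coe_toNNReal _ hM]
      exact hF x y
    exact this.continuous
  let φ : ContDiffBump (0 : E) := ⟨δ / 2, δ, by positivity, by linarith⟩
  let μ : Measure E := Measure.addHaar
  have hφc : Continuous (φ.normed μ) := φ.continuous_normed
  have hint : ∀ x, Integrable (fun t => φ.normed μ t * F (x - t)) μ := by
    intro x
    exact Continuous.integrable_of_hasCompactSupport (by fun_prop)
      (φ.hasCompactSupport_normed.mul_right)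
  refine ⟨convolution (φ.normed μ) F (ContinuousLinearMap.lsmul ℝ ℝ) μ, ?_, ?_, ?_⟩
  · exact φ.hasCompactSupport_normed.contDiff_convolution_left _ φ.contDiff_normed
      hFc.locallyIntegrable
  · intro x y
    simp only [convolution_def, ContinuousLinearMap.lsmul_apply, smul_eq_mul]
    rw [← integral_sub (hint x) (hint y), ← Real.norm_eq_abs]
    have e : M * ‖x - y‖ = ∫ t, φ.normed μ t * (M * ‖x - y‖) ∂μ := by
      rw [integral_mul_const, φ.integral_normed, one_mul]
    rw [e]
    apply norm_integral_le_of_norm_le (φ.integrable_normed.mul_const _)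
    filter_upwards with t
    rw [← mul_sub, Real.norm_eq_abs, abs_mul, abs_of_nonneg (φ.nonneg_normed t)]
    apply mul_le_mul_of_nonneg_left _ (φ.nonneg_normed t)
    simpa using hF (x - t) (y - t)
  · intro x
    rw [← Real.dist_eq]
    apply φ.dist_normed_convolution_le hFc.aestronglyMeasurable
    intro y hy
    rw [Real.dist_eq]
    refine (hF y x).trans (mul_le_mul_of_nonneg_left ?_ hM)
    rw [← dist_eq_norm]
    exact (Metric.mem_ball.1 hy).le

lemma lip_integrable (F : E → ℝ) (M : ℝ) (hM : 0 ≤ M)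
    (hF : ∀ x y, |F x - F y| ≤ M * ‖x - y‖) :
    Continuous F ∧ Integrable F (stdGaussian E) ∧
    ∀ u : ℝ, Integrable (fun x => Real.exp (u * F x)) (stdGaussian E) := by
  have hFc : Continuous F := by
    have : LipschitzWith (Real.toNNReal M) F := by
      apply LipschitzWith.of_dist_le_mul
      intro x y
      rw [Real.dist_eq, dist_eq_norm, Real.coe_toNNReal _ hM]
      exact hF x y
    exact this.continuous
  have hb : ∀ x, |F x| ≤ |F 0| + M * ‖x‖ := by
    intro x
    have h1 := hF x 0
    rw [sub_zero] at h1
    have := abs_sub_abs_le_abs_sub (F x) (F 0)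
    linarith
  refine ⟨hFc, ?_, ?_⟩
  · refine ((integrable_const |F 0|).add
      ((IsGaussian.integrable_id (μ := stdGaussian E)).norm.const_mul M)).mono' (by fun_prop) ?_
    filter_upwards with z
    simpa using hb z
  · intro u
    refine ((integrable_exp_norm_stdG (|u| * M)).const_mul (Real.exp (|u| * |F 0|))).mono'
      (by fun_prop) ?_
    filter_upwards with z
    rw [Real.norm_eq_abs, Real.abs_exp, ← Real.exp_add]
    apply Real.exp_le_exp.2
    have := mul_le_mul_of_nonneg_left (hb z) (abs_nonneg u)
    have h2 := le_abs_self (u * F z)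
    rw [abs_mul] at h2
    linarith

lemma mgf_bound (F : E → ℝ) (M : ℝ) (hM : 0 ≤ M)
    (hF : ∀ x y, |F x - F y| ≤ M * ‖x - y‖) (s : ℝ) (hs : 0 ≤ s) :
    ∫ x, Real.exp (s * F x) ∂(stdGaussian E)
      ≤ Real.exp (s * (∫ x, F x ∂(stdGaussian E)) + M ^ 2 * s ^ 2 / 2) := by
  obtain ⟨hFc, hFi, hFe⟩ := lip_integrable F M hM hF
  set m := ∫ x, F x ∂(stdGaussian E) with hm
  have hT : Filter.Tendsto (fun δ : ℝ => Real.exp (s * m + M ^ 2 * s ^ 2 / 2 + 2 * s * M * δ))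
      (nhdsWithin 0 (Set.Ioi 0)) (nhds (Real.exp (s * m + M ^ 2 * s ^ 2 / 2))) := by
    have : Continuous (fun δ : ℝ => Real.exp (s * m + M ^ 2 * s ^ 2 / 2 + 2 * s * M * δ)) := by
      fun_prop
    have h := this.tendsto 0
    simp only [mul_zero, add_zero] at h
    exact h.mono_left nhdsWithin_le_nhds
  refine ge_of_tendsto hT ?_
  filter_upwards [self_mem_nhdsWithin] with δ hδ
  obtain ⟨g, hg1, hg2, hg3⟩ := mollify F M hM hF δ hδ
  obtain ⟨hgc, hgi, hge⟩ := lip_integrable g M hM hg2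
  have h1 := mgf_bound_smooth g hg1 M hM hg2 s hs
  have h2 : ∫ x, g x ∂(stdGaussian E) ≤ m + M * δ := by
    have : ∫ x, g x ∂(stdGaussian E) ≤ ∫ x, (F x + M * δ) ∂(stdGaussian E) := by
      apply integral_mono hgi (hFi.add (integrable_const _))
      intro x
      have := (abs_le.1 (hg3 x)).2
      simp only [Pi.add_apply]
      linarith
    rw [integral_add hFi (integrable_const _)] at this
    simpa using this
  have h3 : ∫ x, Real.exp (s * F x) ∂(stdGaussian E)
      ≤ ∫ x, Real.exp (s * M * δ) * Real.exp (s * g x) ∂(stdGaussian E) := by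
    apply integral_mono (hFe s) ((hge s).const_mul _)
    intro x
    simp only [← Real.exp_add]
    apply Real.exp_le_exp.2
    have := mul_le_mul_of_nonneg_left (abs_le.1 (hg3 x)).1 hs
    linarith
  rw [integral_const_mul] at h3
  refine h3.trans ((mul_le_mul_of_nonneg_left h1 (Real.exp_pos _).le).trans ?_)
  rw [← Real.exp_add]
  apply Real.exp_le_exp.2
  have := mul_le_mul_of_nonneg_left h2 hs
  linarith

lemma subG_of_lip (F : E → ℝ) (M : ℝ) (hM : 0 ≤ M)
    (hF : ∀ x y, |F x - F y| ≤ M * ‖x - y‖) :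
    HasSubgaussianMGF (fun x => (∫ x, F x ∂(stdGaussian E)) - F x) (Real.toNNReal (M ^ 2))
      (stdGaussian E) := by
  obtain ⟨hFc, hFi, hFe⟩ := lip_integrable F M hM hF
  set m := ∫ x, F x ∂(stdGaussian E) with hm
  have e : ∀ t : ℝ, (fun x => Real.exp (t * (m - F x))) =
      fun x => Real.exp (t * m) * Real.exp (-t * F x) := by
    intro t; ext x; rw [← Real.exp_add]; congr 1; ring
  constructor
  · intro t
    rw [e]
    exact (hFe _).const_mul _
  · intro t
    rw [mgf, e, integral_const_mul, Real.coe_toNNReal _ (sq_nonneg M)]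
    have key : ∫ x, Real.exp (-t * F x) ∂(stdGaussian E) ≤
        Real.exp (-t * m + M ^ 2 * t ^ 2 / 2) := by
      rcases le_total 0 t with ht | ht
      · have := mgf_bound (fun x => - F x) M hM (fun x y => by
          rw [neg_sub_neg, abs_sub_comm]; exact hF x y) t ht
        rw [integral_neg] at this
        simpa using this
      · have := mgf_bound F M hM hF (-t) (by linarith)
        simpa using this
    refine (mul_le_mul_of_nonneg_left key (Real.exp_pos _).le).trans_eq ?_
    rw [← Real.exp_add]; congr 1; ring

end conc

section final

lemma lq_fin (q : ℝ≥0∞) {L : ℕ} (v : Fin L → ℝ) : eLpNorm v q Measure.count ≠ ∞ :=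
  (MemLp.of_discrete (f := v) (p := q) (μ := Measure.count)).eLpNorm_ne_top

lemma lq_nonneg (q : ℝ≥0∞) {L : ℕ} (v : Fin L → ℝ) : 0 ≤ lqNorm q v := ENNReal.toReal_nonneg

lemma lq_add (q : ℝ≥0∞) (hq : 1 ≤ q) {L : ℕ} (v w : Fin L → ℝ) :
    lqNorm q (v + w) ≤ lqNorm q v + lqNorm q w := by
  rw [lqNorm, lqNorm, lqNorm, ← ENNReal.toReal_add (lq_fin q v) (lq_fin q w)]
  exact ENNReal.toReal_mono (ENNReal.add_ne_top.2 ⟨lq_fin q v, lq_fin q w⟩)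
    (eLpNorm_add_le (Measurable.of_discrete.aestronglyMeasurable)
      (Measurable.of_discrete.aestronglyMeasurable) hq)

lemma lq_smul (q : ℝ≥0∞) {L : ℕ} (c : ℝ) (v : Fin L → ℝ) :
    lqNorm q (c • v) = |c| * lqNorm q v := by
  rw [lqNorm, lqNorm, eLpNorm_const_smul, ENNReal.toReal_mul]
  simp

lemma lq_mono (q : ℝ≥0∞) {L : ℕ} (v w : Fin L → ℝ) (h : ∀ j, |v j| ≤ w j) :
    lqNorm q v ≤ lqNorm q w :=
  ENNReal.toReal_mono (lq_fin q w) (eLpNorm_mono_real h)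

lemma lq_lip (n L : ℕ) (hn : 1 ≤ n) (X : Fin n → Fin L → ℝ) (q : ℝ≥0∞) (hq : 1 ≤ q)
    (x y : EuclideanSpace ℝ (Fin n)) :
    |lqNorm q (fun j => (1 / (n : ℝ)) * ∑ i, X i j * x i) -
      lqNorm q (fun j => (1 / (n : ℝ)) * ∑ i, X i j * y i)| ≤ (Nq q X / Real.sqrt n) * ‖x - y‖ := by
  have hn0 : (0 : ℝ) < n := by exact_mod_cast hn
  have hs : 0 < Real.sqrt n := Real.sqrt_pos.2 hn0
  have main : ∀ x y : EuclideanSpace ℝ (Fin n),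
      lqNorm q (fun j => (1 / (n : ℝ)) * ∑ i, X i j * x i) -
      lqNorm q (fun j => (1 / (n : ℝ)) * ∑ i, X i j * y i) ≤ (Nq q X / Real.sqrt n) * ‖x - y‖ := by
    intro x y
    have h1 : lqNorm q (fun j => (1 / (n : ℝ)) * ∑ i, X i j * x i) ≤
        lqNorm q (fun j => (1 / (n : ℝ)) * ∑ i, X i j * (x - y) i) +
        lqNorm q (fun j => (1 / (n : ℝ)) * ∑ i, X i j * y i) := by
      refine le_trans (le_of_eq ?_) (lq_add q hq _ _)
      congr 1; ext j
      simp only [Pi.add_apply, ← mul_add, ← Finset.sum_add_distrib]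
      congr 1
      apply Finset.sum_congr rfl
      intro i _
      simp
    have h2 : lqNorm q (fun j => (1 / (n : ℝ)) * ∑ i, X i j * (x - y) i) ≤
        lqNorm q ((‖x - y‖ / Real.sqrt n) •
          (fun j => Real.sqrt ((1 / (n : ℝ)) * ∑ i, (X i j) ^ 2))) := by
      apply lq_mono
      intro j
      have hcs : |∑ i, X i j * (x - y) i| ≤ Real.sqrt (∑ i, (X i j) ^ 2) * ‖x - y‖ := by
        rw [EuclideanSpace.norm_eq, ← Real.sqrt_mul (by positivity)]
        simp only [Real.norm_eq_abs, sq_abs]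
        exact Real.abs_le_sqrt (Finset.sum_mul_sq_le_sq_mul_sq _ _ _)
      rw [abs_mul, abs_of_nonneg (by positivity : (0 : ℝ) ≤ 1 / n)]
      simp only [Pi.smul_apply, smul_eq_mul]
      rw [Real.sqrt_mul (by positivity), Real.sqrt_div (by norm_num), Real.sqrt_one]
      calc _ ≤ 1 / (n : ℝ) * (Real.sqrt (∑ i, (X i j) ^ 2) * ‖x - y‖) := by gcongr
        _ = 1 / (Real.sqrt n * Real.sqrt n) * (Real.sqrt (∑ i, (X i j) ^ 2) * ‖x - y‖) := by
          rw [Real.mul_self_sqrt hn0.le]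
        _ = _ := by field_simp
    rw [lq_smul, abs_of_nonneg (by positivity)] at h2
    have h3 : ‖x - y‖ / Real.sqrt n * lqNorm q (fun j => Real.sqrt ((1 / (n : ℝ)) * ∑ i, (X i j) ^ 2))
      = (Nq q X / Real.sqrt n) * ‖x - y‖ := by rw [Nq]; ring
    linarith
  rw [abs_le]
  have h1 := main x y
  have h2 := main y x
  rw [norm_sub_rev] at h2
  constructor <;> linarith

lemma gaussianVec_one (n : ℕ) :
    gaussianVec n 1 = Measure.pi (fun _ : Fin n => gaussianReal 0 1) := by
  have : (⟨1 ^ 2, sq_nonneg 1⟩ : ℝ≥0) = 1 := by ext; simp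
  rw [gaussianVec, this]
  rfl

lemma gaussianVec_map (n : ℕ) (σ : ℝ) :
    gaussianVec n σ = (gaussianVec n 1).map (fun x i => σ * x i) := by
  rw [gaussianVec_one, Measure.pi_map_pi (fun _ => by fun_prop), gaussianVec]
  congr 1; ext1 i
  rw [gaussianReal_map_const_mul]
  simp
  rfl

lemma subG_eval {Ω : Type*} [MeasurableSpace Ω] {R : ℕ} (μ : Measure Ω) [IsProbabilityMeasure μ]
    (Y : Ω → ℝ) (c : ℝ≥0) (h : HasSubgaussianMGF Y c μ) (r : Fin R) :
    HasSubgaussianMGF (fun z : Fin R → Ω => Y (z r)) c (Measure.pi (fun _ : Fin R => μ)) := by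
  have hmp : (Measure.pi (fun _ : Fin R => μ)).map (fun z => z r) = μ :=
    (measurePreserving_eval (fun _ : Fin R => μ) r).map_eq
  have h' : HasSubgaussianMGF Y c ((Measure.pi (fun _ : Fin R => μ)).map (fun z => z r)) := by
    rw [hmp]; exact h
  exact HasSubgaussianMGF.of_map (Y := fun z : Fin R → Ω => z r) (X := Y)
    (measurable_pi_apply r).aemeasurable h'

end final

/-- Monte Carlo lower-deviation bound, eq. (c2). -/
theorem monte_carlo_lower_deviation
    (n L R : ℕ) (hn : 1 ≤ n) (hL : 1 ≤ L) (hR : 1 ≤ R) (X : Fin n → Fin L → ℝ)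
    (σ : ℝ) (hσ : 0 < σ) (q : ℝ≥0∞) (hq : 1 ≤ q) (t : ℝ) (ht : 0 ≤ t) :
    ((Measure.pi (fun _ : Fin R => gaussianVec n 1))
        {z : Fin R → Fin n → ℝ |
          (∫ w, lqNorm q (fun j => (1 / (n : ℝ)) * ∑ i, X i j * w i)
              ∂(gaussianVec n σ))
            ≥ (σ / R) * ∑ r, lqNorm q (fun j => (1 / (n : ℝ)) * ∑ i, X i j * z r i)
              + t}).toReal
      ≤ Real.exp (-(n * R * t ^ 2) / (2 * σ ^ 2 * (Nq q X) ^ 2)) := by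
  have hn0 : (0 : ℝ) < n := by exact_mod_cast hn
  have hR0 : (0 : ℝ) < R := by exact_mod_cast hR
  have hNq : 0 ≤ Nq q X := lq_nonneg _ _
  have : IsProbabilityMeasure (gaussianVec n 1) := by
    rw [gaussianVec_one]; infer_instance
  set f : (Fin n → ℝ) → ℝ := fun w => lqNorm q (fun j => (1 / (n : ℝ)) * ∑ i, X i j * w i) with hf
  set M := Nq q X / Real.sqrt n with hM
  have hM0 : 0 ≤ M := by positivity
  have hmap : (gaussianVec n 1).map (WithLp.toLp 2) = stdGaussian (EuclideanSpace ℝ (Fin n)) := by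
    rw [gaussianVec_one, map_pi_eq_stdGaussian]
  set F : EuclideanSpace ℝ (Fin n) → ℝ := fun x => f x.ofLp with hF
  have hlip : ∀ x y, |F x - F y| ≤ M * ‖x - y‖ := fun x y => lq_lip n L hn X q hq x y
  have hFc : Continuous F := (lip_integrable F M hM0 hlip).1
  have hfc : Continuous f := by
    have : f = F ∘ (WithLp.toLp 2) := rfl
    rw [this]; fun_prop
  have hsub := subG_of_lip F M hM0 hlip
  set m := ∫ x, F x ∂(stdGaussian (EuclideanSpace ℝ (Fin n))) with hm
  have hm' : ∫ w, f w ∂(gaussianVec n σ) = σ * m := by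
    rw [gaussianVec_map, integral_map (Measurable.aemeasurable (by fun_prop)) hfc.aestronglyMeasurable, hm, ← hmap,
      integral_map (by fun_prop) hFc.aestronglyMeasurable, ← integral_const_mul]
    congr 1; ext x
    have := lq_smul q σ (fun j => (1 / (n : ℝ)) * ∑ i, X i j * x i)
    rw [abs_of_pos hσ] at this
    simp only [hF, hf]
    rw [← this]
    congr 1; ext j
    simp only [Pi.smul_apply, smul_eq_mul]
    rw [Finset.mul_sum, Finset.mul_sum, Finset.mul_sum]
    apply Finset.sum_congr rfl
    intro i _; ring
  rw [hm']
  rw [← hmap] at hsub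
  have hsub1 : HasSubgaussianMGF (fun w => m - f w) (Real.toNNReal (M ^ 2)) (gaussianVec n 1) :=
    HasSubgaussianMGF.of_map (Y := WithLp.toLp 2) (X := fun x => m - F x) (by fun_prop) hsub
  have hind : iIndepFun (fun (r : Fin R) (z : Fin R → Fin n → ℝ) => m - f (z r))
      (Measure.pi (fun _ : Fin R => gaussianVec n 1)) :=
    iIndepFun_pi (X := fun _ w => m - f w) (fun _ => by fun_prop)
  have hsub2 : ∀ r ∈ (Finset.univ : Finset (Fin R)),
      HasSubgaussianMGF (fun z : Fin R → Fin n → ℝ => m - f (z r)) (Real.toNNReal (M ^ 2))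
      (Measure.pi (fun _ : Fin R => gaussianVec n 1)) := by
    intro r _
    exact subG_eval (gaussianVec n 1) (fun w => m - f w) _ hsub1 r
  have hε : 0 ≤ R * t / σ := by positivity
  have hfin := HasSubgaussianMGF.measure_sum_ge_le_of_iIndepFun hind
    (c := fun _ => Real.toNNReal (M ^ 2)) hsub2 hε
  refine le_trans (le_of_eq ?_) (hfin.trans_eq ?_)
  · rw [Measure.real]
    congr 2
    ext z
    simp only [Set.mem_ofPred_eq, ge_iff_le, Finset.sum_sub_distrib, Finset.sum_const,
      Finset.card_univ, Fintype.card_fin, nsmul_eq_mul]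
    rw [div_le_iff₀ hσ]
    have e : σ / R * ∑ r, f (z r) + t = (σ * ∑ r, f (z r) + R * t) / R := by field_simp
    rw [e, div_le_iff₀ hR0]
    constructor <;> intro h <;> linarith
  · congr 1
    have hMM : M ^ 2 = Nq q X ^ 2 / n := by
      rw [hM, div_pow, Real.sq_sqrt hn0.le]
    simp only [Finset.sum_const, Finset.card_univ, Fintype.card_fin, nsmul_eq_mul]
    push_cast
    rw [Real.coe_toNNReal _ (sq_nonneg M), hMM]
    by_cases h0 : Nq q X = 0
    · simp [h0]
    · field_simp
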